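/- If a nonsingular cubic surface C in ℙ³(ℂ) contains five distinct twistor lines a₁,…,a₅, then there exists a line b lying on C such that j(b) ≠ b, j(b) also lies on C, and each of the five twistor lines a₁,…,a₅ meets both b and j(b). -/

import Mathlib

noncomputable section

open MvPolynomial

/-- The standard twistor structure `j : ℂ⁴ → ℂ⁴`,
`j(z₁,z₂,z₃,z₄) = (−z̄₂, z̄₁, −z̄₄, z̄₃)`. -/
def J : (Fin 4 → ℂ) → (Fin 4 → ℂ) :=
  fun z => ![-(starRingEnd ℂ) (z 1), (starRingEnd ℂ) (z 0),
             -(starRingEnd ℂ) (z 3), (starRingEnd ℂ) (z 2)]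

/-- A line in `ℙ³(ℂ)`: a 2-dimensional `ℂ`-subspace of `ℂ⁴`. -/
def IsLine (W : Submodule ℂ (Fin 4 → ℂ)) : Prop := Module.finrank ℂ W = 2

/-- A twistor line: a line whose underlying subspace satisfies `j(W) = W`. -/
def IsTwistorLine (W : Submodule ℂ (Fin 4 → ℂ)) : Prop :=
  IsLine W ∧ J '' (W : Set (Fin 4 → ℂ)) = (W : Set (Fin 4 → ℂ))

/-- A polynomial vanishes identically on a subspace. -/
def VanishesOn (f : MvPolynomial (Fin 4) ℂ) (W : Submodule ℂ (Fin 4 → ℂ)) : Prop :=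
  ∀ z ∈ W, eval z f = 0

/-- The surface `{f = 0}` is nonsingular: no nonzero point of `ℂ⁴` is a common zero of
`f` and all its partial derivatives. -/
def Nonsingular (f : MvPolynomial (Fin 4) ℂ) : Prop :=
  ∀ z : Fin 4 → ℂ, z ≠ 0 → eval z f = 0 → ∃ i, eval z (pderiv i f) ≠ 0

section Polarization

/-- The coefficients of the symmetric tensor of a cubic form, up to the factor `6`. -/
def thirdPartial (f : MvPolynomial (Fin 4) ℂ) (i j k : Fin 4) : ℂ :=
  eval 0 (pderiv i (pderiv j (pderiv k f)))

lemma pderiv_pderiv_comm (f : MvPolynomial (Fin 4) ℂ) (i j : Fin 4) :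
    pderiv i (pderiv j f) = pderiv j (pderiv i f) := by
  have h : ⁅pderiv (R := ℂ) i, pderiv (R := ℂ) j⁆ = 0 := by
    ext k
    simp [Derivation.commutator_apply, pderiv_X, Pi.single_apply, apply_ite]
  have h' := congrArg (fun D => D f) h
  simpa [Derivation.commutator_apply, sub_eq_zero] using h'

/-- The polarization of a cubic form, normalized so that its diagonal is six times the form. -/
def polarForm (f : MvPolynomial (Fin 4) ℂ) :
    (Fin 4 → ℂ) →ₗ[ℂ] (Fin 4 → ℂ) →ₗ[ℂ] (Fin 4 → ℂ) →ₗ[ℂ] ℂ :=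
  LinearMap.mk₂ ℂ
    (fun u v => ∑ k, (∑ i, ∑ j, u i * v j * thirdPartial f i j k) • LinearMap.proj k)
    (fun u u' v => by simp only [Pi.add_apply, add_mul, Finset.sum_add_distrib, add_smul])
    (fun c u v => by
      simp only [Pi.smul_apply, smul_eq_mul, mul_assoc, ← Finset.mul_sum, mul_smul,
        ← Finset.smul_sum])
    (fun u v v' => by
      simp only [Pi.add_apply, mul_add, add_mul, Finset.sum_add_distrib, add_smul])
    (fun c u v => by
      simp only [Pi.smul_apply, smul_eq_mul, mul_assoc, mul_left_comm _ c, ← Finset.mul_sum,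
        mul_smul, ← Finset.smul_sum])

lemma polarForm_apply (f : MvPolynomial (Fin 4) ℂ) (u v w : Fin 4 → ℂ) :
    polarForm f u v w = ∑ k, (∑ i, ∑ j, u i * v j * thirdPartial f i j k) * w k := by
  simp [polarForm]

lemma polarForm_swap_left (f : MvPolynomial (Fin 4) ℂ) (u v w : Fin 4 → ℂ) :
    polarForm f u v w = polarForm f v u w := by
  simp only [polarForm_apply]
  refine Finset.sum_congr rfl fun k _ => ?_
  rw [Finset.sum_comm]
  congr 1
  refine Finset.sum_congr rfl fun i _ => Finset.sum_congr rfl fun j _ => ?_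
  rw [thirdPartial, pderiv_pderiv_comm, thirdPartial]
  ring

lemma polarForm_swap_right (f : MvPolynomial (Fin 4) ℂ) (u v w : Fin 4 → ℂ) :
    polarForm f u v w = polarForm f u w v := by
  simp only [polarForm_apply, Finset.sum_mul]
  rw [Finset.sum_comm]
  conv_rhs => rw [Finset.sum_comm]
  refine Finset.sum_congr rfl fun i _ => ?_
  rw [Finset.sum_comm]
  refine Finset.sum_congr rfl fun j _ => Finset.sum_congr rfl fun k _ => ?_
  rw [thirdPartial, thirdPartial, pderiv_pderiv_comm f j k]
  ring

lemma eval_eq_eval_zero_of_isHomogeneous_zero {g : MvPolynomial (Fin 4) ℂ}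
    (hg : g.IsHomogeneous 0) (z : Fin 4 → ℂ) : eval z g = eval 0 g := by
  rw [← totalDegree_zero_iff_isHomogeneous, totalDegree_eq_zero_iff_eq_C] at hg
  rw [hg, eval_C, eval_C]

lemma sum_mul_eval_pderiv {g : MvPolynomial (Fin 4) ℂ} {n : ℕ} (hg : g.IsHomogeneous n)
    (z : Fin 4 → ℂ) : ∑ i, z i * eval z (pderiv i g) = n * eval z g := by
  simpa using congrArg (eval z) hg.sum_X_mul_pderiv

lemma polarForm_diag_left {f : MvPolynomial (Fin 4) ℂ} (hf : f.IsHomogeneous 3)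
    (z w : Fin 4 → ℂ) : polarForm f z z w = 2 * ∑ k, w k * eval z (pderiv k f) := by
  rw [polarForm_apply, Finset.mul_sum]
  refine Finset.sum_congr rfl fun k _ => ?_
  have h1 : (pderiv k f).IsHomogeneous 2 := hf.pderiv
  have e1 := sum_mul_eval_pderiv h1 z
  have e2 : ∀ j, eval z (pderiv j (pderiv k f)) = ∑ i, z i * thirdPartial f i j k := by
    intro j
    have h2 : (pderiv j (pderiv k f)).IsHomogeneous 1 := h1.pderiv
    have e := sum_mul_eval_pderiv h2 z
    rw [Nat.cast_one, one_mul] at e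
    rw [← e]
    refine Finset.sum_congr rfl fun i _ => ?_
    have h3 : (pderiv i (pderiv j (pderiv k f))).IsHomogeneous 0 := h2.pderiv
    rw [thirdPartial, eval_eq_eval_zero_of_isHomogeneous_zero h3]
  have e3 : ∑ i, ∑ j, z i * z j * thirdPartial f i j k = 2 * eval z (pderiv k f) := by
    rw [Finset.sum_comm]
    push_cast at e1
    rw [← e1]
    refine Finset.sum_congr rfl fun j _ => ?_
    rw [e2, Finset.mul_sum]
    exact Finset.sum_congr rfl fun i _ => by ring
  rw [e3]
  ring

lemma polarForm_diag {f : MvPolynomial (Fin 4) ℂ} (hf : f.IsHomogeneous 3)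
    (z : Fin 4 → ℂ) : polarForm f z z z = 6 * eval z f := by
  rw [polarForm_diag_left hf, sum_mul_eval_pderiv hf]
  push_cast
  ring

lemma Nonsingular.exists_polarForm_ne_zero {f : MvPolynomial (Fin 4) ℂ}
    (hf : f.IsHomogeneous 3) (hns : Nonsingular f) {z : Fin 4 → ℂ} (hz : z ≠ 0) :
    ∃ w, polarForm f z z w ≠ 0 := by
  by_contra! h
  have h0 : eval z f = 0 := by
    have := h z
    rw [polarForm_diag hf] at this
    simpa using this
  obtain ⟨i, hi⟩ := hns z hz h0
  have := h (Pi.single i 1)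
  rw [polarForm_diag_left hf] at this
  simp [Pi.single_apply, hi] at this

end Polarization

section TrilinearForm

variable {V : Type*} [AddCommGroup V] [Module ℂ V]

lemma trilinear_diag_pair (F : V →ₗ[ℂ] V →ₗ[ℂ] V →ₗ[ℂ] ℂ)
    (h₁ : ∀ u v w, F u v w = F v u w) (h₂ : ∀ u v w, F u v w = F u w v)
    (p q : V) (s t : ℂ) :
    F (s • p + t • q) (s • p + t • q) (s • p + t • q) =
      s ^ 3 * F p p p + 3 * s ^ 2 * t * F p p q + 3 * s * t ^ 2 * F p q q + t ^ 3 * F q q q := by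
  simp only [map_add, map_smul, LinearMap.add_apply, LinearMap.smul_apply, smul_eq_mul]
  linear_combination (-2 * s ^ 2 * t) * h₂ p p q - 2 * s * t ^ 2 * h₁ p q q
    + s ^ 2 * t * (h₁ q p p) - s * t ^ 2 * h₂ q p q

/-- A cubic form vanishing at four distinct points of a line vanishes on the line. -/
lemma trilinear_diag_eq_zero_of_four (F : V →ₗ[ℂ] V →ₗ[ℂ] V →ₗ[ℂ] ℂ)
    (h₁ : ∀ u v w, F u v w = F v u w) (h₂ : ∀ u v w, F u v w = F u w v)
    {p q : V} {c : ℂ} (hc0 : c ≠ 0) (hc1 : c ≠ 1) (hp : F p p p = 0) (hq : F q q q = 0)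
    (hpq : F (p + q) (p + q) (p + q) = 0)
    (hc : F (p + c • q) (p + c • q) (p + c • q) = 0) :
    F p p q = 0 ∧ F p q q = 0 := by
  have e1 := trilinear_diag_pair F h₁ h₂ p q 1 1
  have e2 := trilinear_diag_pair F h₁ h₂ p q 1 c
  simp only [one_smul, hp, hq, hpq, hc] at e1 e2
  have h : (3 * c * (c - 1)) * F p q q = 0 := by linear_combination c * e1 - e2
  have h0 : F p q q = 0 := by
    simpa [hc0, sub_eq_zero, hc1] using h
  refine ⟨?_, h0⟩
  rw [h0] at e1
  linear_combination -e1 / 3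

/-- A cubic form which vanishes on two skew lines `⟨p, q⟩`, `⟨P, Q⟩`, on the three transversals
`⟨p, P⟩`, `⟨q, Q⟩`, `⟨p + q, P + Q⟩`, and on a line skew to all five, is singular at some point
of `⟨p, q⟩`. -/
lemma exists_singular_point (F : V →ₗ[ℂ] V →ₗ[ℂ] V →ₗ[ℂ] ℂ)
    (h₁ : ∀ u v w, F u v w = F v u w) (h₂ : ∀ u v w, F u v w = F u w v)
    {p q P Q : V} {α β γ δ : ℂ}
    (hb : ∀ s t : ℂ, F (s • p + t • q) (s • p + t • q) (s • p + t • q) = 0)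
    (hB : ∀ s t : ℂ, F (s • P + t • Q) (s • P + t • Q) (s • P + t • Q) = 0)
    (h1 : ∀ s t : ℂ, F (s • p + t • P) (s • p + t • P) (s • p + t • P) = 0)
    (h2 : ∀ s t : ℂ, F (s • q + t • Q) (s • q + t • Q) (s • q + t • Q) = 0)
    (h3 : ∀ s t : ℂ, F (s • (p + q) + t • (P + Q)) (s • (p + q) + t • (P + Q))
      (s • (p + q) + t • (P + Q)) = 0)
    (h5 : ∀ s t : ℂ, F (s • (p + (α • P + β • Q)) + t • (q + (γ • P + δ • Q)))
      (s • (p + (α • P + β • Q)) + t • (q + (γ • P + δ • Q)))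
      (s • (p + (α • P + β • Q)) + t • (q + (γ • P + δ • Q))) = 0)
    (hβ : β ≠ 0) (hγ : γ ≠ 0) (hne : α + γ ≠ β + δ) (hdet : α * δ - β * γ ≠ 0) :
    ∃ s t : ℂ, (s ≠ 0 ∨ t ≠ 0) ∧ ∀ x y z w : ℂ,
      F (s • p + t • q) (s • p + t • q) (x • p + y • q + z • P + w • Q) = 0 := by
  have mid : ∀ u v : V,
      (∀ s t : ℂ, F (s • u + t • v) (s • u + t • v) (s • u + t • v) = 0) →
      F u u u = 0 ∧ F u u v = 0 ∧ F u v v = 0 ∧ F v v v = 0 := by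
    intro u v h
    have hu : F u u u = 0 := by simpa using h 1 0
    have hv : F v v v = 0 := by simpa using h 0 1
    have := trilinear_diag_eq_zero_of_four F h₁ h₂ (c := 2) two_ne_zero (by norm_num) hu hv
      (by simpa using h 1 1) (by simpa using h 1 2)
    exact ⟨hu, this.1, this.2, hv⟩
  obtain ⟨ppp, ppq, pqq, qqq⟩ := mid _ _ hb
  obtain ⟨PPP, PPQ, PQQ, QQQ⟩ := mid _ _ hB
  obtain ⟨-, ppP, pPP, -⟩ := mid _ _ h1
  obtain ⟨-, qqQ, qQQ, -⟩ := mid _ _ h2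
  obtain ⟨-, e1, e2, -⟩ := mid _ _ h3
  obtain ⟨e3, e4, e5, e6⟩ := mid _ _ h5
  have pqp : F p q p = 0 := by rw [h₂, ppq]
  have qpp : F q p p = 0 := by rw [h₁, pqp]
  have qpq : F q p q = 0 := by rw [h₁, pqq]
  have qqp : F q q p = 0 := by rw [h₂, qpq]
  have PQP : F P Q P = 0 := by rw [h₂, PPQ]
  have QPP : F Q P P = 0 := by rw [h₁, PQP]
  have QPQ : F Q P Q = 0 := by rw [h₁, PQQ]
  have QQP : F Q Q P = 0 := by rw [h₂, QPQ]
  have pPp : F p P p = 0 := by rw [h₂, ppP]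
  have Ppp : F P p p = 0 := by rw [h₁, pPp]
  have PpP : F P p P = 0 := by rw [h₁, pPP]
  have PPp : F P P p = 0 := by rw [h₂, PpP]
  have qQq : F q Q q = 0 := by rw [h₂, qqQ]
  have Qqq : F Q q q = 0 := by rw [h₁, qQq]
  have QqQ : F Q q Q = 0 := by rw [h₁, qQQ]
  have QQq : F Q Q q = 0 := by rw [h₂, QqQ]
  have pQp : F p Q p = F p p Q := h₂ ..
  have Qpp : F Q p p = F p p Q := by rw [h₁, pQp]
  have qPq : F q P q = F q q P := h₂ ..
  have Pqq : F P q q = F q q P := by rw [h₁, qPq]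
  have QpQ : F Q p Q = F p Q Q := h₁ ..
  have QQp : F Q Q p = F p Q Q := by rw [h₂, QpQ]
  have PqP : F P q P = F q P P := h₁ ..
  have PPq : F P P q = F q P P := by rw [h₂, PqP]
  have pPq : F p P q = F p q P := h₂ ..
  have qpP : F q p P = F p q P := h₁ ..
  have Ppq : F P p q = F p q P := by rw [h₁, pPq]
  have pQq : F p Q q = F p q Q := h₂ ..
  have qpQ : F q p Q = F p q Q := h₁ ..
  have Qpq : F Q p q = F p q Q := by rw [h₁, pQq]
  have pQP : F p Q P = F p P Q := h₂ ..
  have PpQ : F P p Q = F p P Q := h₁ ..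
  have PQp : F P Q p = F p P Q := by rw [h₂, PpQ]
  have QpP : F Q p P = F p P Q := by rw [h₁, pQP]
  have QPp : F Q P p = F p P Q := by rw [h₁, PQp]
  have qQP : F q Q P = F q P Q := h₂ ..
  have PqQ : F P q Q = F q P Q := h₁ ..
  have PQq : F P Q q = F q P Q := by rw [h₂, PqQ]
  have QqP : F Q q P = F q P Q := by rw [h₁, qQP]
  have QPq : F Q P q = F q P Q := by rw [h₁, PQq]
  simp only [map_add, map_smul, LinearMap.add_apply, LinearMap.smul_apply, smul_eq_mul,
    ppp, ppq, pqq, qqq, PPP, PPQ, PQQ, QQQ, ppP, pPP, qqQ, qQQ, pqp, qpp, qpq, qqp, PQP, QPP, QPQ,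
    QQP, pPp, Ppp, PpP, PPp, qQq, Qqq, QqQ, QQq, pQp, Qpp, qPq, Pqq, QpQ, QQp, PqP, PPq, pPq, qpP,
    Ppq, pQq, qpQ, Qpq, pQP, PpQ, PQp, QpP, QPp, qQP, PqQ, PQq, QqP,
    QPq] at e1 e2 e3 e4 e5 e6 ⊢
  generalize F p p Q = c₁ at *
  generalize F p q P = c₂ at *
  generalize F p q Q = c₃ at *
  generalize F q q P = c₄ at *
  generalize F p Q Q = d₁ at *
  generalize F p P Q = d₂ at *
  generalize F q P Q = d₃ at *
  generalize F q P P = d₄ at *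
  have a1 : c₁ + 2 * α * d₂ + β * d₁ = 0 := by
    apply mul_left_cancel₀ hβ
    linear_combination e3 / 3
  have a2 : c₄ + γ * d₄ + 2 * δ * d₃ = 0 := by
    apply mul_left_cancel₀ hγ
    linear_combination e6 / 3
  -- the two mixed conditions determine `c₂` and `c₃`
  have a3 : α * (2 * c₂ + α * d₄ + 2 * β * d₃) + β * (2 * c₃ + 2 * γ * d₂ + δ * d₁) = 0 := by
    linear_combination e4 - δ * a1
  have a4 : γ * (2 * c₂ + α * d₄ + 2 * β * d₃) + δ * (2 * c₃ + 2 * γ * d₂ + δ * d₁) = 0 := by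
    linear_combination e5 - α * a2
  have a5 : 2 * c₂ + α * d₄ + 2 * β * d₃ = 0 := by
    apply mul_left_cancel₀ hdet
    linear_combination δ * a3 - β * a4
  have a6 : 2 * c₃ + 2 * γ * d₂ + δ * d₁ = 0 := by
    apply mul_left_cancel₀ hdet
    linear_combination α * a4 - γ * a3
  have a7 : 2 * d₂ + d₄ = 0 := by
    apply mul_left_cancel₀ (sub_ne_zero.mpr hne)
    linear_combination -e1 + a1 + a2 + a5 + a6 - (β + δ) * e2
  have a8 : c₁ + 2 * c₂ = 0 := by
    linear_combination a1 + a5 - α * a7 - β * (e2 - a7)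
  have a9 : c₄ + 2 * c₃ = 0 := by
    linear_combination a2 + a6 - γ * a7 - δ * (e2 - a7)
  by_cases h0 : c₁ = 0
  · refine ⟨1, 0, Or.inl one_ne_zero, fun x y z w => ?_⟩
    rw [h0]
    ring
  · refine ⟨2 * c₃, -c₁, Or.inr (neg_ne_zero.mpr h0), fun x y z w => ?_⟩
    linear_combination (-2 * z * c₁ * c₃) * a8 + z * c₁ ^ 2 * a9

end TrilinearForm

section TwistorLine

lemma J_add (u v : Fin 4 → ℂ) : J (u + v) = J u + J v := by
  ext i; fin_cases i <;> simp [J] <;> ring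

lemma J_smul (c : ℂ) (u : Fin 4 → ℂ) : J (c • u) = (starRingEnd ℂ) c • J u := by
  ext i; fin_cases i <;> simp [J]

lemma J_J (u : Fin 4 → ℂ) : J (J u) = -u := by
  ext i; fin_cases i <;> simp [J]

lemma J_zero : J 0 = 0 := by
  ext i; fin_cases i <;> simp [J]

lemma J_ne_zero {u : Fin 4 → ℂ} (hu : u ≠ 0) : J u ≠ 0 := fun h => hu <| by
  rw [← neg_eq_zero, ← J_J, h, J_zero]

lemma smul_add_smul_J_eq_zero {z : Fin 4 → ℂ} (hz : z ≠ 0) {s t : ℂ}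
    (h : s • z + t • J z = 0) : s = 0 ∧ t = 0 := by
  have h' : (starRingEnd ℂ) s • J z - (starRingEnd ℂ) t • z = 0 := by
    have := congrArg J h
    rw [J_add, J_smul, J_smul, J_J, J_zero] at this
    rw [← this]
    module
  have h2 : ((starRingEnd ℂ) s * s + t * (starRingEnd ℂ) t) • z = 0 := by
    have : ((starRingEnd ℂ) s * s + t * (starRingEnd ℂ) t) • z =
        (starRingEnd ℂ) s • (s • z + t • J z)
          - t • ((starRingEnd ℂ) s • J z - (starRingEnd ℂ) t • z) := by module
    rw [this, h, h']
    simp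
  have h3 := (smul_eq_zero.mp h2).resolve_right hz
  rw [mul_comm, Complex.mul_conj, Complex.mul_conj] at h3
  have h4 : Complex.normSq s + Complex.normSq t = 0 := by exact_mod_cast h3
  have hs := Complex.normSq_nonneg s
  have ht := Complex.normSq_nonneg t
  exact ⟨Complex.normSq_eq_zero.mp (by linarith), Complex.normSq_eq_zero.mp (by linarith)⟩

lemma finrank_span_pair {u v : Fin 4 → ℂ}
    (h : ∀ s t : ℂ, s • u + t • v = 0 → s = 0 ∧ t = 0) :
    Module.finrank ℂ (Submodule.span ℂ {u, v}) = 2 := by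
  have hli : LinearIndependent ℂ ![u, v] := LinearIndependent.pair_iff.mpr h
  rw [← Matrix.range_cons_cons_empty u v ![]]
  simpa using finrank_span_eq_card hli

namespace IsTwistorLine

variable {W W' : Submodule ℂ (Fin 4 → ℂ)}

lemma J_mem (h : IsTwistorLine W) {z : Fin 4 → ℂ} (hz : z ∈ W) : J z ∈ W := by
  rw [← SetLike.mem_coe, ← h.2]
  exact ⟨z, hz, rfl⟩

lemma eq_span (h : IsTwistorLine W) {z : Fin 4 → ℂ} (hz : z ∈ W) (h0 : z ≠ 0) :
    Submodule.span ℂ {z, J z} = W := by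
  refine Submodule.eq_of_le_of_finrank_eq ?_ ?_
  · rw [Submodule.span_le]
    rintro x (rfl | rfl)
    exacts [hz, h.J_mem hz]
  · rw [finrank_span_pair fun s t => smul_add_smul_J_eq_zero h0]
    exact h.1.symm

lemma eq_of_mem (h : IsTwistorLine W) (h' : IsTwistorLine W') {z : Fin 4 → ℂ} (h0 : z ≠ 0)
    (hz : z ∈ W) (hz' : z ∈ W') : W = W' := by
  rw [← h.eq_span hz h0, h'.eq_span hz' h0]

lemma disjoint (h : IsTwistorLine W) (h' : IsTwistorLine W') (hne : W ≠ W') : Disjoint W W' :=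
  Submodule.disjoint_def.mpr fun _ hz hz' => by_contra fun h0 => hne (h.eq_of_mem h' h0 hz hz')

end IsTwistorLine

end TwistorLine

section Transversal

lemma isCompl_of_disjoint {W W' : Submodule ℂ (Fin 4 → ℂ)} (h : IsLine W) (h' : IsLine W')
    (hd : Disjoint W W') : IsCompl W W' := by
  unfold IsLine at h h'
  rw [Submodule.isCompl_iff_disjoint _ _ (by simp [h, h'])]
  exact hd

/-- Projection from one of two skew lines onto the other, restricted to a line skew to the
centre, is an isomorphism. -/
def projEquiv {A B W : Submodule ℂ (Fin 4 → ℂ)} (hAB : IsCompl A B) (hA : IsLine A)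
    (hW : IsLine W) (hd : Disjoint W B) : W ≃ₗ[ℂ] A :=
  LinearEquiv.ofInjectiveOfFinrankEq ((A.projectionOnto B hAB).domRestrict W)
    ((injective_iff_map_eq_zero _).mpr fun w hw => by
      have : (w : Fin 4 → ℂ) ∈ B := (Submodule.projectionOnto_apply_eq_zero_iff hAB).mp hw
      exact Subtype.ext (Submodule.disjoint_def.mp hd _ w.2 this))
    (hW.trans hA.symm)

lemma projEquiv_add_projEquiv {A B W : Submodule ℂ (Fin 4 → ℂ)} (hAB : IsCompl A B)
    (hA : IsLine A) (hB : IsLine B) (hW : IsLine W) (hdA : Disjoint W A) (hdB : Disjoint W B)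
    (w : W) :
    (projEquiv hAB hA hW hdB w : Fin 4 → ℂ) + projEquiv hAB.symm hB hW hdA w = w :=
  Submodule.projection_add_projection_eq_self hAB _

/-- Four pairwise skew lines have a common transversal. -/
lemma exists_transversal {A B C D : Submodule ℂ (Fin 4 → ℂ)} (hA : IsLine A) (hB : IsLine B)
    (hC : IsLine C) (hD : IsLine D) (hAB : Disjoint A B) (hCA : Disjoint C A)
    (hCB : Disjoint C B) (hDA : Disjoint D A) (hDB : Disjoint D B) :
    ∃ p ∈ A, ∃ q ∈ B, ∃ c : ℂ, p ≠ 0 ∧ q ≠ 0 ∧ p + q ∈ C ∧ p + c • q ∈ D := by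
  have hc := isCompl_of_disjoint hA hB hAB
  let α := projEquiv hc hA hC hCB
  let β := projEquiv hc.symm hB hC hCA
  let γ := projEquiv hc hA hD hDB
  let δ := projEquiv hc.symm hB hD hDA
  have : Nontrivial C := Module.nontrivial_of_finrank_pos (R := ℂ) (by rw [hC]; norm_num)
  obtain ⟨c, h⟩ := Module.End.exists_eigenvalue
    (((α.trans γ.symm).trans (δ.trans β.symm)).toLinearMap : Module.End ℂ C)
  obtain ⟨w, hw⟩ := h.exists_hasEigenvector
  have hw0 : w ≠ 0 := hw.2
  have hw' : δ (γ.symm (α w)) = c • β w := by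
    have := hw.apply_eq_smul
    simp only [LinearEquiv.coe_coe, LinearEquiv.trans_apply] at this
    rw [LinearEquiv.symm_apply_eq] at this
    simpa using this
  refine ⟨α w, (α w).2, β w, (β w).2, c, ?_, ?_, ?_, ?_⟩
  · simpa using hw0
  · simpa using hw0
  · rw [projEquiv_add_projEquiv hc hA hB hC hCA hCB w]
    exact w.2
  · have e := projEquiv_add_projEquiv hc hA hB hD hDA hDB (γ.symm (α w))
    change (γ (γ.symm (α w)) : Fin 4 → ℂ) + δ (γ.symm (α w)) = _ at e
    rw [hw', LinearEquiv.apply_symm_apply] at e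
    rw [← Submodule.coe_smul, e]
    exact (γ.symm (α w)).2

end Transversal


/-- If a nonsingular cubic surface contains five distinct twistor lines `a₁,…,a₅`,
then there is a line `b` on the surface with `j(b) ≠ b`, `j(b)` also on the surface,
and every `aᵢ` meeting both `b` and `j(b)`. -/
theorem five_twistor_lines_have_transversal (f : MvPolynomial (Fin 4) ℂ) (hf0 : f ≠ 0)
    (hhom : f.IsHomogeneous 3) (hns : Nonsingular f)
    (a : Fin 5 → Submodule ℂ (Fin 4 → ℂ)) (hinj : Function.Injective a)
    (ha : ∀ i, IsTwistorLine (a i)) (hav : ∀ i, VanishesOn f (a i)) :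
    ∃ b : Submodule ℂ (Fin 4 → ℂ), IsLine b ∧ VanishesOn f b ∧
      J '' (b : Set (Fin 4 → ℂ)) ≠ (b : Set (Fin 4 → ℂ)) ∧
      (∀ z ∈ b, eval (J z) f = 0) ∧
      (∀ i, a i ⊓ b ≠ ⊥ ∧ ∃ z ∈ b, J z ≠ 0 ∧ J z ∈ a i) := by
  have hd : ∀ i k, i ≠ k → Disjoint (a i) (a k) := fun i k h =>
    (ha i).disjoint (ha k) (hinj.ne h)
  have hne : ∀ {i k z}, i ≠ k → z ∈ a i → z ∈ a k → z = 0 := fun h hi hk =>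
    Submodule.disjoint_def.mp (hd _ _ h) _ hi hk
  obtain ⟨p, hp, q, hq, c, hp0, hq0, h2, h3⟩ :=
    exists_transversal (ha 0).1 (ha 1).1 (ha 2).1 (ha 3).1 (hd 0 1 (by decide))
      (hd 2 0 (by decide)) (hd 2 1 (by decide)) (hd 3 0 (by decide)) (hd 3 1 (by decide))
  have hind : ∀ s t : ℂ, s • p + t • q = 0 → s = 0 ∧ t = 0 := by
    intro s t h
    have hs : s • p = 0 := hne (i := 0) (k := 1) (by decide) ((a 0).smul_mem _ hp) <| by
      rw [eq_neg_of_add_eq_zero_left h]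
      exact (a 1).neg_mem ((a 1).smul_mem _ hq)
    rw [hs, zero_add] at h
    exact ⟨(smul_eq_zero.mp hs).resolve_right hp0, (smul_eq_zero.mp h).resolve_right hq0⟩
  have hpq0 : p + q ≠ 0 := fun h => one_ne_zero (hind 1 1 (by simpa using h)).1
  have hpc0 : p + c • q ≠ 0 := fun h => one_ne_zero (hind 1 c (by simpa using h)).1
  have hc0 : c ≠ 0 := by
    rintro rfl
    exact hp0 (hne (i := 0) (k := 3) (by decide) hp (by simpa using h3))
  have hc1 : c ≠ 1 := by
    rintro rfl
    exact hpq0 (hne (i := 2) (k := 3) (by decide) h2 (by simpa using h3))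
  have hJp := (ha 0).J_mem hp
  have hJq := (ha 1).J_mem hq
  have hJ2 := (ha 2).J_mem h2
  have hJ3 := (ha 3).J_mem h3
  rw [J_add] at hJ2
  rw [J_add, J_smul] at hJ3
  have hJb : ∀ s t : ℂ, J (s • p + t • q) =
      (starRingEnd ℂ) s • J p + (starRingEnd ℂ) t • J q := fun s t => by
    rw [J_add, J_smul, J_smul]
  have hF1 := polarForm_swap_left f
  have hF2 := polarForm_swap_right f
  have hFa : ∀ {i z}, z ∈ a i → polarForm f z z z = 0 := fun {i z} hz => by
    rw [polarForm_diag hhom, hav i z hz, mul_zero]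
  have hFb : ∀ s t : ℂ,
      polarForm f (s • p + t • q) (s • p + t • q) (s • p + t • q) = 0 := by
    intro s t
    obtain ⟨e1, e2⟩ := trilinear_diag_eq_zero_of_four (polarForm f) hF1 hF2 hc0 hc1
      (hFa hp) (hFa hq) (hFa h2) (hFa h3)
    rw [trilinear_diag_pair _ hF1 hF2, e1, e2, hFa hp, hFa hq]
    ring
  have hFB : ∀ s t : ℂ,
      polarForm f (s • J p + t • J q) (s • J p + t • J q) (s • J p + t • J q) = 0 := by
    intro s t
    obtain ⟨e1, e2⟩ := trilinear_diag_eq_zero_of_four (polarForm f) hF1 hF2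
      (c := (starRingEnd ℂ) c) (by simpa using hc0) ((map_ne_one_iff _ (starRingEnd ℂ).injective).mpr hc1)
      (hFa hJp) (hFa hJq) (hFa hJ2) (hFa hJ3)
    rw [trilinear_diag_pair _ hF1 hF2, e1, e2, hFa hJp, hFa hJq]
    ring
  have hF0 : ∀ z, polarForm f z z z = 0 → eval z f = 0 := fun z h => by
    rw [polarForm_diag hhom] at h
    simpa using h
  have hpb : p ∈ Submodule.span ℂ {p, q} := Submodule.subset_span (by simp)
  have hqb : q ∈ Submodule.span ℂ {p, q} := Submodule.subset_span (by simp)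
  have hmeet : ∃ z ∈ Submodule.span ℂ {p, q}, z ≠ 0 ∧ z ∈ a 4 := by
    by_contra! hskew
    have hskew' : ∀ s t : ℂ, s • p + t • q ∈ a 4 → s = 0 ∧ t = 0 := fun s t h =>
      hind s t <| by_contra fun h0 =>
        hskew _ (Submodule.mem_span_pair.mpr ⟨s, t, rfl⟩) h0 h
    have hskewJ : ∀ s t : ℂ, s • J p + t • J q ∈ a 4 → s = 0 ∧ t = 0 := by
      intro s t h
      have h' := (a 4).neg_mem ((ha 4).J_mem h)
      rw [J_add, J_smul, J_smul, J_J, J_J, smul_neg, smul_neg, ← neg_add, neg_neg] at h'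
      simpa using hskew' _ _ h'
    have hcompl : IsCompl (Submodule.span ℂ {J p, J q}) (a 4) := by
      refine isCompl_of_disjoint (finrank_span_pair fun s t h => hskewJ s t ?_) (ha 4).1 ?_
      · rw [h]
        exact (a 4).zero_mem
      · rw [Submodule.disjoint_def]
        intro z hz hz'
        obtain ⟨s, t, rfl⟩ := Submodule.mem_span_pair.mp hz
        obtain ⟨rfl, rfl⟩ := hskewJ s t hz'
        simp
    have hlift : ∀ v : Fin 4 → ℂ, ∃ x y : ℂ, v + (x • J p + y • J q) ∈ a 4 := by
      intro v
      have hv : v ∈ Submodule.span ℂ {J p, J q} ⊔ a 4 := by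
        rw [hcompl.sup_eq_top]
        trivial
      obtain ⟨g, hg, w, hw, rfl⟩ := Submodule.mem_sup.mp hv
      obtain ⟨x, y, rfl⟩ := Submodule.mem_span_pair.mp hg
      refine ⟨-x, -y, ?_⟩
      convert hw using 1
      module
    obtain ⟨α, β, hg1⟩ := hlift p
    obtain ⟨γ, δ, hg2⟩ := hlift q
    have hnotmem : ∀ {i z} (x : ℂ), i ≠ 4 → z ≠ 0 → z ∈ a i → z + x • J z ∉ a 4 := by
      intro i z x hi hz hzi hz4
      have h := hne hi ((a i).add_mem hzi ((a i).smul_mem x ((ha i).J_mem hzi))) hz4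
      exact one_ne_zero (smul_add_smul_J_eq_zero hz (s := 1) (by simpa using h)).1
    have hβ : β ≠ 0 := by
      rintro rfl
      exact hnotmem (i := 0) α (by decide) hp0 hp (by simpa using hg1)
    have hγ : γ ≠ 0 := by
      rintro rfl
      exact hnotmem (i := 1) δ (by decide) hq0 hq (by simpa using hg2)
    have hne' : α + γ ≠ β + δ := by
      intro h
      refine hnotmem (i := 2) (α + γ) (by decide) hpq0 h2 ?_
      convert (a 4).add_mem hg1 hg2 using 1
      rw [J_add, smul_add]
      nth_rewrite 2 [h]
      module
    have hdet : α * δ - β * γ ≠ 0 := by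
      intro h
      refine hβ (neg_eq_zero.mp (hskew' δ (-β) ?_).2)
      convert (a 4).sub_mem ((a 4).smul_mem δ hg1) ((a 4).smul_mem β hg2) using 1
      have : δ • (p + (α • J p + β • J q)) - β • (q + (γ • J p + δ • J q)) =
          δ • p + -β • q + (α * δ - β * γ) • J p := by module
      rw [this, h, zero_smul, add_zero]
    have hmem : ∀ {i u v}, u ∈ a i → v ∈ a i → ∀ s t : ℂ, s • u + t • v ∈ a i :=
      fun hu hv s t => (a _).add_mem ((a _).smul_mem s hu) ((a _).smul_mem t hv)
    obtain ⟨s, t, hst, hsing⟩ := exists_singular_point (polarForm f) hF1 hF2 hFb hFB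
      (fun s t => hFa (hmem hp hJp s t)) (fun s t => hFa (hmem hq hJq s t))
      (fun s t => hFa (hmem h2 hJ2 s t)) (fun s t => hFa (hmem hg1 hg2 s t)) hβ hγ hne' hdet
    have hz : s • p + t • q ≠ 0 := fun h => by
      obtain ⟨rfl, rfl⟩ := hind s t h
      simp at hst
    obtain ⟨v, hv⟩ := hns.exists_polarForm_ne_zero hhom hz
    apply hv
    have hv' : v ∈ a 0 ⊔ a 1 := by
      rw [(isCompl_of_disjoint (ha 0).1 (ha 1).1 (hd 0 1 (by decide))).sup_eq_top]
      trivial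
    obtain ⟨v0, hv0, v1, hv1, rfl⟩ := Submodule.mem_sup.mp hv'
    rw [← (ha 0).eq_span hp hp0] at hv0
    rw [← (ha 1).eq_span hq hq0] at hv1
    obtain ⟨x, z, rfl⟩ := Submodule.mem_span_pair.mp hv0
    obtain ⟨y, w, rfl⟩ := Submodule.mem_span_pair.mp hv1
    rw [← hsing x y z w]
    congr 1
    abel
  refine ⟨Submodule.span ℂ {p, q}, finrank_span_pair hind, ?_, ?_, ?_, ?_⟩
  · intro z hz
    obtain ⟨s, t, rfl⟩ := Submodule.mem_span_pair.mp hz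
    exact hF0 _ (hFb s t)
  · intro h
    have hb : IsTwistorLine (Submodule.span ℂ {p, q}) := ⟨finrank_span_pair hind, h⟩
    exact hinj.ne (show (0 : Fin 5) ≠ 1 by decide)
      (((ha 0).eq_of_mem hb hp0 hp hpb).trans (hb.eq_of_mem (ha 1) hq0 hqb hq))
  · intro z hz
    obtain ⟨s, t, rfl⟩ := Submodule.mem_span_pair.mp hz
    rw [hJb]
    exact hF0 _ (hFB _ _)
  · have key : ∀ i, ∃ z ∈ Submodule.span ℂ {p, q}, z ≠ 0 ∧ z ∈ a i := by
      intro i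
      fin_cases i
      · exact ⟨p, hpb, hp0, hp⟩
      · exact ⟨q, hqb, hq0, hq⟩
      · exact ⟨_, add_mem hpb hqb, hpq0, h2⟩
      · exact ⟨_, add_mem hpb (Submodule.smul_mem _ c hqb), hpc0, h3⟩
      · exact hmeet
    intro i
    obtain ⟨z, hz, hz0, hzi⟩ := key i
    exact ⟨(Submodule.ne_bot_iff _).mpr ⟨z, ⟨hzi, hz⟩, hz0⟩, z, hz, J_ne_zero hz0,
      (ha i).J_mem hzi⟩
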